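/- Let n ≥ 2, q ≥ 2, m = n−1, and R ∈ {1,…,m}. The minimum of H^In_{1-Del}(y) over all y ∈ Σ_{q,R}^m equals log₂(nq) − ((m−R+2) log₂(m−R+2) + 2(R−1))/(nq), and this minimum is attained exactly by the skewed words of Σ_{q,R}^m. -/

import Mathlib

open scoped Classical

noncomputable section

/-- The embedding number `ω_y(x)`: the number of distinct occurrences of `y`
as a subsequence of `x` (i.e. the number of index tuples realizing `y` in `x`). -/
def emb {q : ℕ} (y x : List (Fin q)) : ℕ := x.sublists.count y

/-- The run length profile of a word: the list of lengths of its maximal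
blocks of identical consecutive symbols, in order. -/
def runLengths {α : Type*} [DecidableEq α] : List α → List ℕ
  | [] => []
  | [_] => [1]
  | a :: b :: l =>
    if a = b then
      match runLengths (b :: l) with
      | [] => [1]
      | r :: rs => (r + 1) :: rs
    else 1 :: runLengths (b :: l)

/-- Input entropy `H^In_{k-Del}(y)` of the `k`-deletion channel over `Σ_q`
under uniform transmission, for a channel output `y ∈ Σ_q^{n-k}`:
`-∑_{x ∈ I_k(y)} p(x) log₂ p(x)` with `p(x) = ω_y(x) / (C(n,k) q^k)`. -/
def Hdel (q n k : ℕ) (y : Fin (n - k) → Fin q) : ℝ :=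
  - ∑ x ∈ Finset.univ.filter
      (fun x : Fin n → Fin q => (List.ofFn y).Sublist (List.ofFn x)),
      ((emb (List.ofFn y) (List.ofFn x) : ℝ) / ((n.choose k : ℝ) * (q : ℝ) ^ k)) *
        Real.logb 2 ((emb (List.ofFn y) (List.ofFn x) : ℝ) / ((n.choose k : ℝ) * (q : ℝ) ^ k))

/-- Input entropy `H^In_{k-Ins}(y)` of the `k`-insertion channel over `Σ_q`
under uniform transmission, for a channel output `y ∈ Σ_q^{n+k}`:
`-∑_{x ∈ D_k(y)} p(x) log₂ p(x)` with `p(x) = ω_x(y) / C(n+k,k)`. -/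
def Hins (q n k : ℕ) (y : Fin (n + k) → Fin q) : ℝ :=
  - ∑ x ∈ Finset.univ.filter
      (fun x : Fin n → Fin q => (List.ofFn x).Sublist (List.ofFn y)),
      ((emb (List.ofFn x) (List.ofFn y) : ℝ) / ((n + k).choose k : ℝ)) *
        Real.logb 2 ((emb (List.ofFn x) (List.ofFn y) : ℝ) / ((n + k).choose k : ℝ))

/-- A run length profile `rl` of a word of length `m` with `R` runs is balanced if it
consists of `m mod R` runs of length `⌈m/R⌉` and `R - (m mod R)` runs of length `⌊m/R⌋`. -/
def isBalanced (m R : ℕ) (rl : List ℕ) : Prop :=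
  rl.Perm (List.replicate (m % R) ((m + R - 1) / R) ++ List.replicate (R - m % R) (m / R))

/-- A run length profile `rl` of a word of length `m` with `R` runs is skewed if it
consists of `R - 1` runs of length `1` and a single run of length `m - (R-1)`. -/
def isSkewed (m R : ℕ) (rl : List ℕ) : Prop :=
  rl.Perm ((m - (R - 1)) :: List.replicate (R - 1) 1)

/-- `fIdx rl i` is the smallest (1-based) index `j ∈ [i+1, R]` with `r_j > 1`;
it is `R` if no such index exists, and `fIdx rl R = R`. -/
def fIdx (rl : List ℕ) (i : ℕ) : ℕ :=
  if i = rl.length then rl.length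
  else if {j | i + 1 ≤ j ∧ j ≤ rl.length ∧ 1 < rl.getD (j - 1) 0}.Nonempty
    then sInf {j | i + 1 ≤ j ∧ j ≤ rl.length ∧ 1 < rl.getD (j - 1) 0}
    else rl.length

/-- `bIdx rl i` is the largest (1-based) index `j ∈ [1, i]` with `r_j > 1`;
it is `1` if no such index exists, and `bIdx rl 0 = 1`. -/
def bIdx (rl : List ℕ) (i : ℕ) : ℕ :=
  if i = 0 then 1
  else if {j | 1 ≤ j ∧ j ≤ i ∧ 1 < rl.getD (j - 1) 0}.Nonempty
    then sSup {j | 1 ≤ j ∧ j ≤ i ∧ 1 < rl.getD (j - 1) 0}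
    else 1

section Embedding

variable {q : ℕ}

theorem emb_nil_left (x : List (Fin q)) : emb [] x = 1 := by
  induction x with
  | nil => simp [emb]
  | cons b x ih =>
    rw [emb] at ih ⊢
    rw [(List.sublists_cons_perm_append b x).count_eq, List.count_append, ih,
      List.count_eq_zero_of_not_mem (by simp)]

theorem emb_cons_cons (a b : Fin q) (y x : List (Fin q)) :
    emb (a :: y) (b :: x) = emb (a :: y) x + if a = b then emb y x else 0 := by
  unfold emb
  rw [(List.sublists_cons_perm_append b x).count_eq, List.count_append]
  split_ifs with h
  · subst h
    rw [List.count_map_of_injective _ _ (List.cons_injective)]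
  · rw [List.count_eq_zero_of_not_mem (l := List.map _ _)]
    simp [Ne.symm h]

theorem emb_eq_zero {y x : List (Fin q)} (h : ¬ y.Sublist x) : emb y x = 0 :=
  List.count_eq_zero_of_not_mem (by simpa using h)

theorem emb_self (y : List (Fin q)) : emb y y = 1 := by
  induction y with
  | nil => exact emb_nil_left _
  | cons a y ih =>
    rw [emb_cons_cons, emb_eq_zero (fun h => by simpa using h.length_le), ih]
    simp

theorem emb_of_length_eq {y x : List (Fin q)} (h : y.length = x.length) :
    emb y x = if x = y then 1 else 0 := by
  split_ifs with hxy
  · rw [hxy, emb_self]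
  · exact emb_eq_zero fun hs => hxy (hs.eq_of_length h).symm

theorem emb_cons_self_cons (a b : Fin q) (l : List (Fin q)) :
    emb (b :: l) (a :: b :: l) = 1 + if a = b then emb l (b :: l) else 0 := by
  rw [emb_cons_cons, emb_self]
  simp only [eq_comm]

/-- Sums over words decompose according to the first letter. -/
theorem sum_ofFn_succ (k : ℕ) (G : List (Fin q) → ℝ) :
    ∑ x : Fin (k + 1) → Fin q, G (List.ofFn x) =
      ∑ b : Fin q, ∑ x : Fin k → Fin q, G (b :: List.ofFn x) := by
  rw [← Fintype.sum_prod_type' (f := fun b (x : Fin k → Fin q) => G (b :: List.ofFn x))]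
  refine (Fintype.sum_equiv (Fin.consEquiv fun _ => Fin q) _ _ ?_).symm
  rintro ⟨b, x⟩
  simp [Fin.consEquiv]

theorem exists_ofFn_eq {α : Type*} {l : List α} {m : ℕ} (h : l.length = m) :
    ∃ y : Fin m → α, List.ofFn y = l := by
  subst h
  exact ⟨l.get, List.ofFn_get l⟩

theorem sum_ofFn_ite_eq {l : List (Fin q)} {k : ℕ} (h : l.length = k)
    (G : List (Fin q) → ℝ) :
    ∑ x : Fin k → Fin q, (if List.ofFn x = l then G (List.ofFn x) else 0) = G l := by
  obtain ⟨x₀, rfl⟩ := exists_ofFn_eq h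
  simp [List.ofFn_inj]

/-- Recursion, in the first letter of `y`, for sums of a function of the embedding number
over the words that are one letter longer than `y`. -/
theorem sum_emb_cons (F : ℕ → ℝ) (F_zero : F 0 = 0) (a : Fin q) (l : List (Fin q)) :
    ∑ x : Fin (l.length + 2) → Fin q, F (emb (a :: l) (List.ofFn x)) =
      ∑ x : Fin (l.length + 1) → Fin q, F (emb l (List.ofFn x))
        + ((q : ℝ) - 1) * F 1 + (F (1 + emb l (a :: l)) - F (emb l (a :: l))) := by
  rw [sum_ofFn_succ (l.length + 1) fun x => F (emb (a :: l) x)]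
  have key : ∀ b : Fin q,
      ∑ x : Fin (l.length + 1) → Fin q, F (emb (a :: l) (b :: List.ofFn x)) =
        F 1 + if a = b then ∑ x : Fin (l.length + 1) → Fin q, F (emb l (List.ofFn x))
          + (F (1 + emb l (a :: l)) - F (emb l (a :: l))) - F 1 else 0 := by
    intro b
    split_ifs with hab
    · subst hab
      rw [← sum_ofFn_ite_eq (l := a :: l) (k := l.length + 1) rfl
        (fun x => F (1 + emb l x) - F (emb l x)), ← Finset.sum_add_distrib]
      rw [add_sub_cancel]
      refine Finset.sum_congr rfl fun x _ => ?_
      rw [emb_cons_cons, emb_of_length_eq (by simp), if_pos rfl]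
      split_ifs <;> simp
    · rw [← sum_ofFn_ite_eq (l := a :: l) (k := l.length + 1) rfl (fun _ => F 1), add_zero]
      refine Finset.sum_congr rfl fun x _ => ?_
      rw [emb_cons_cons, emb_of_length_eq (by simp)]
      split_ifs <;> simp [F_zero]
  rw [Finset.sum_congr rfl fun b _ => key b, Finset.sum_add_distrib]
  simp
  ring

theorem sum_emb (l : List (Fin q)) :
    ∑ x : Fin (l.length + 1) → Fin q, (emb l (List.ofFn x) : ℝ) = (l.length + 1) * q := by
  induction l with
  | nil => simp [emb_nil_left]
  | cons a l ih =>
    have h := sum_emb_cons (fun n => (n : ℝ)) (by simp) a l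
    rw [ih] at h
    rw [List.length_cons, h]
    push_cast
    ring

end Embedding

section RunLengths

variable {α : Type*} [DecidableEq α]

theorem runLengths_cons_ne_nil (a : α) (l : List α) : runLengths (a :: l) ≠ [] := by
  cases l with
  | nil => simp [runLengths]
  | cons b l =>
    rw [runLengths]
    split_ifs
    · split <;> simp
    · simp

theorem runLengths_cons_cons_of_ne {a b : α} (h : a ≠ b) (l : List α) :
    runLengths (a :: b :: l) = 1 :: runLengths (b :: l) := by
  rw [runLengths, if_neg h]

theorem runLengths_cons_cons_self {a : α} {l : List α} {r : ℕ} {rs : List ℕ}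
    (h : runLengths (a :: l) = r :: rs) : runLengths (a :: a :: l) = (r + 1) :: rs := by
  rw [runLengths, if_pos rfl, h]

theorem exists_runLengths_cons (a : α) (l : List α) :
    ∃ r rs, runLengths (a :: l) = r :: rs :=
  List.exists_cons_of_ne_nil (runLengths_cons_ne_nil a l)

theorem one_le_of_mem_runLengths (l : List α) : ∀ r ∈ runLengths l, 1 ≤ r := by
  induction l with
  | nil => simp [runLengths]
  | cons a l ih =>
    cases l with
    | nil => simp [runLengths]
    | cons b l =>
      by_cases h : a = b
      · subst h
        obtain ⟨r, rs, hr⟩ := exists_runLengths_cons a l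
        rw [runLengths_cons_cons_self hr]
        rw [hr] at ih
        simp_all
      · rw [runLengths_cons_cons_of_ne h]
        simpa using ih

theorem sum_runLengths (l : List α) : (runLengths l).sum = l.length := by
  induction l with
  | nil => simp [runLengths]
  | cons a l ih =>
    cases l with
    | nil => simp [runLengths]
    | cons b l =>
      by_cases h : a = b
      · subst h
        obtain ⟨r, rs, hr⟩ := exists_runLengths_cons a l
        rw [runLengths_cons_cons_self hr]
        rw [hr] at ih
        simp only [List.sum_cons, List.length_cons] at ih ⊢
        omega
      · rw [runLengths_cons_cons_of_ne h, List.sum_cons, ih, List.length_cons (a := a)]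
        omega

theorem runLengths_replicate (a : α) (k : ℕ) :
    runLengths (a :: List.replicate k a) = [k + 1] := by
  induction k with
  | zero => simp [runLengths]
  | succ k ih =>
    rw [List.replicate_succ]
    exact runLengths_cons_cons_self ih

theorem exists_runLengths_eq_replicate_append [Nontrivial α] (j k : ℕ) (a : α) :
    ∃ l, runLengths (a :: l) = List.replicate j 1 ++ [k + 1] := by
  induction j generalizing a with
  | zero => exact ⟨_, runLengths_replicate a k⟩
  | succ j ih =>
    obtain ⟨b, hb⟩ := exists_ne a
    obtain ⟨l, hl⟩ := ih b
    refine ⟨b :: l, ?_⟩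
    rw [runLengths_cons_cons_of_ne hb.symm, hl]
    simp [List.replicate_succ]

end RunLengths

theorem runLengths_cons_eq_emb {q : ℕ} (a : Fin q) (l : List (Fin q)) :
    ∃ rs, runLengths (a :: l) = emb l (a :: l) :: rs := by
  induction l generalizing a with
  | nil => exact ⟨[], by simp [runLengths, emb_nil_left]⟩
  | cons b l ih =>
    rw [emb_cons_self_cons]
    by_cases h : a = b
    · subst h
      obtain ⟨rs, hrs⟩ := ih a
      exact ⟨rs, by rw [runLengths_cons_cons_self hrs, if_pos rfl, add_comm]⟩
    · exact ⟨_, by rw [runLengths_cons_cons_of_ne h, if_neg h]⟩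

/-- If `F` vanishes at `0` and `1`, only the words extending a run of `y` contribute to the sum
of `F` over embedding numbers of `y`. -/
theorem sum_emb_eq_sum_runLengths {q : ℕ} (F : ℕ → ℝ) (F_zero : F 0 = 0) (F_one : F 1 = 0)
    (l : List (Fin q)) :
    ∑ x : Fin (l.length + 1) → Fin q, F (emb l (List.ofFn x)) =
      ((runLengths l).map fun r => F (r + 1)).sum := by
  induction l with
  | nil => simp [emb_nil_left, runLengths, F_one]
  | cons a l ih =>
    rw [List.length_cons, sum_emb_cons F F_zero, ih, F_one]
    cases l with
    | nil => simp [runLengths, emb_nil_left, F_one]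
    | cons b l =>
      rw [emb_cons_self_cons]
      obtain ⟨rs, hrs⟩ := runLengths_cons_eq_emb b l
      by_cases h : a = b
      · subst h
        rw [runLengths_cons_cons_self hrs, hrs, if_pos rfl]
        simp only [List.map_cons, List.sum_cons]
        rw [show 1 + (1 + emb l (a :: l)) = emb l (a :: l) + 1 + 1 by ring,
          add_comm 1 (emb l (a :: l))]
        ring
      · rw [runLengths_cons_cons_of_ne h, if_neg h]
        simp only [List.map_cons, List.sum_cons, add_zero, F_one]
        ring

/-- The function `w ↦ w log₂ w` on the naturals. -/
def mulLogb (w : ℕ) : ℝ := w * Real.logb 2 w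

theorem mulLogb_zero : mulLogb 0 = 0 := by simp [mulLogb]

theorem mulLogb_one : mulLogb 1 = 0 := by simp [mulLogb]

theorem mulLogb_two : mulLogb 2 = 2 := by simp [mulLogb]

theorem mulLogb_add_lt {r s : ℕ} (hr : 1 < r) (hs : 1 < s) :
    mulLogb (r + 1) + mulLogb (s + 1) < mulLogb (r + s) + mulLogb 2 := by
  have h2 : 0 < Real.log 2 := Real.log_pos one_lt_two
  have hr' : (1 : ℝ) < r := by exact_mod_cast hr
  have hs' : (1 : ℝ) < s := by exact_mod_cast hs
  have hd : (0 : ℝ) < r + s - 2 := by linarith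
  have hx : ((r : ℝ) + s) ∈ Set.Ici (0 : ℝ) := by simp only [Set.mem_Ici]; linarith
  have hy : (2 : ℝ) ∈ Set.Ici (0 : ℝ) := by simp
  have hne : (r : ℝ) + s ≠ 2 := by linarith
  have ht : 0 < ((r : ℝ) - 1) / (r + s - 2) := div_pos (by linarith) hd
  have hu : 0 < ((s : ℝ) - 1) / (r + s - 2) := div_pos (by linarith) hd
  have htu : ((r : ℝ) - 1) / (r + s - 2) + (s - 1) / (r + s - 2) = 1 := by
    field_simp
    ring
  have h₁ := Real.strictConvexOn_mul_log.2 hx hy hne ht hu htu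
  have h₂ := Real.strictConvexOn_mul_log.2 hx hy hne hu ht (by rw [add_comm, htu])
  have e₁ : ((r : ℝ) - 1) / (r + s - 2) * (r + s) + (s - 1) / (r + s - 2) * 2 = r + 1 := by
    field_simp
    ring
  have e₂ : ((s : ℝ) - 1) / (r + s - 2) * (r + s) + (r - 1) / (r + s - 2) * 2 = s + 1 := by
    field_simp
    ring
  simp only [smul_eq_mul] at h₁ h₂
  rw [e₁] at h₁
  rw [e₂] at h₂
  have h := add_lt_add h₁ h₂
  have e₃ : ∀ t u A B : ℝ, t + u = 1 → t * A + u * B + (u * A + t * B) = A + B := by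
    intro t u A B htu
    linear_combination (A + B) * htu
  rw [e₃ _ _ _ _ htu] at h
  have h' := div_lt_div_of_pos_right h h2
  simp only [mulLogb, Real.logb]
  push_cast
  calc _ = _ := by ring
    _ < _ := h'
    _ = _ := by ring

theorem mulLogb_add_le {r s : ℕ} (hr : 1 ≤ r) (hs : 1 ≤ s) :
    mulLogb (r + 1) + mulLogb (s + 1) ≤ mulLogb (r + s) + mulLogb 2 := by
  rcases hr.eq_or_lt with rfl | hr
  · rw [add_comm, add_comm s]
  · rcases hs.eq_or_lt with rfl | hs
    · exact le_rfl
    · exact (mulLogb_add_lt hr hs).le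

theorem length_le_sum_of_one_le {rs : List ℕ} (h : ∀ r ∈ rs, 1 ≤ r) : rs.length ≤ rs.sum := by
  simpa using rs.card_nsmul_le_sum 1 h

/-- Among lists of positive integers with prescribed length and sum, the skewed ones are the
maximizers of `∑ mulLogb (r + 1)`. -/
theorem sum_mulLogb_le (rs : List ℕ) (h : ∀ r ∈ rs, 1 ≤ r) (hne : rs ≠ []) :
    (rs.map fun r => mulLogb (r + 1)).sum ≤
        mulLogb (rs.sum - rs.length + 2) + 2 * ((rs.length - 1 : ℕ) : ℝ) ∧
      ((rs.map fun r => mulLogb (r + 1)).sum =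
          mulLogb (rs.sum - rs.length + 2) + 2 * ((rs.length - 1 : ℕ) : ℝ) →
        isSkewed rs.sum rs.length rs) := by
  induction rs with
  | nil => exact absurd rfl hne
  | cons r rs ih =>
    have hr : 1 ≤ r := h r (by simp)
    rcases eq_or_ne rs [] with rfl | hne'
    · obtain ⟨k, rfl⟩ := Nat.exists_eq_add_of_le' hr
      simp [isSkewed]
    · have hrs : ∀ r ∈ rs, 1 ≤ r := fun r hr => h r (by simp [hr])
      obtain ⟨ih₁, ih₂⟩ := ih hrs hne'
      have hlen := length_le_sum_of_one_le hrs
      have hpos : 0 < rs.length := List.length_pos_iff.2 hne'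
      obtain ⟨M, hM⟩ := Nat.exists_eq_add_of_le' hlen
      obtain ⟨j, hj⟩ := Nat.exists_eq_add_of_le' (Nat.succ_le_of_lt hpos)
      simp only [List.map_cons, List.sum_cons, List.length_cons, isSkewed] at ih₁ ih₂ ⊢
      rw [show r + rs.sum - (rs.length + 1) + 2 = r + (M + 1) by omega]
      rw [show rs.sum - rs.length + 2 = M + 1 + 1 by omega] at ih₁ ih₂
      have hle := mulLogb_add_le hr (Nat.le_add_left 1 M)
      rw [mulLogb_two] at hle
      have hcast : ((rs.length + 1 - 1 : ℕ) : ℝ) = ((rs.length - 1 : ℕ) : ℝ) + 1 := by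
        rw [hj]
        simp
      rw [hcast]
      refine ⟨by linarith, fun heq => ?_⟩
      have hperm := ih₂ (by linarith)
      rw [show rs.sum - (rs.length - 1) = M + 1 by omega,
        show rs.length - 1 = j by omega] at hperm
      rw [show r + rs.sum - (rs.length + 1 - 1) = r + M by omega,
        show rs.length + 1 - 1 = j + 1 by omega, List.replicate_succ]
      by_cases hr1 : r = 1
      · subst hr1
        rw [add_comm 1 M]
        exact (hperm.cons 1).trans (List.Perm.swap _ _ _)
      · have hM0 : M = 0 := by
          by_contra hM0
          have := mulLogb_add_lt (r := r) (s := M + 1) (by omega) (by omega)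
          rw [mulLogb_two] at this
          linarith
        subst hM0
        simpa using hperm.cons r

theorem sum_mulLogb_of_isSkewed {m R : ℕ} {rs : List ℕ} (hR : 1 ≤ R) (hRm : R ≤ m)
    (h : isSkewed m R rs) :
    (rs.map fun r => mulLogb (r + 1)).sum =
      mulLogb (m - R + 2) + 2 * ((R - 1 : ℕ) : ℝ) := by
  rw [(h.map _).sum_eq, List.map_cons, List.sum_cons, List.map_replicate, List.sum_replicate,
    one_add_one_eq_two, mulLogb_two, show m - (R - 1) + 1 = m - R + 2 by omega]
  simp [mul_comm]

/-- The input entropy of the single-deletion channel in terms of run lengths. -/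
theorem Hdel_one_eq {q m : ℕ} (hq : 0 < q) (y : Fin m → Fin q) :
    Hdel q (m + 1) 1 y = Real.logb 2 (((m : ℝ) + 1) * q) -
      ((runLengths (List.ofFn y)).map fun r => mulLogb (r + 1)).sum / (((m : ℝ) + 1) * q) := by
  have hN : (0 : ℝ) < ((m : ℝ) + 1) * q := by positivity
  have hlen : (List.ofFn y).length = m := List.length_ofFn
  have h₁ := sum_emb (List.ofFn y)
  have h₂ := sum_emb_eq_sum_runLengths mulLogb mulLogb_zero mulLogb_one (List.ofFn y)
  rw [hlen] at h₁ h₂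
  have hterm : ∀ w : ℕ, (w : ℝ) / (((m : ℝ) + 1) * q) * Real.logb 2 (w / (((m : ℝ) + 1) * q)) =
      mulLogb w / (((m : ℝ) + 1) * q)
        - w * (Real.logb 2 (((m : ℝ) + 1) * q) / (((m : ℝ) + 1) * q)) := by
    intro w
    rcases eq_or_ne w 0 with rfl | hw
    · simp [mulLogb]
    · rw [Real.logb_div (by exact_mod_cast hw) hN.ne', mulLogb]
      ring
  have hsum : Hdel q (m + 1) 1 y = -∑ x : Fin (m + 1) → Fin q,
      (mulLogb (emb (List.ofFn y) (List.ofFn x)) / (((m : ℝ) + 1) * q)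
        - emb (List.ofFn y) (List.ofFn x) *
          (Real.logb 2 (((m : ℝ) + 1) * q) / (((m : ℝ) + 1) * q))) := by
    unfold Hdel
    rw [Finset.sum_filter_of_ne]
    · congr 1
      refine Finset.sum_congr rfl fun x _ => ?_
      rw [← hterm]
      simp
    · intro x _ hx
      by_contra hs
      apply hx
      have : emb (List.ofFn y) (List.ofFn x) = 0 := emb_eq_zero hs
      simp only [this, Nat.cast_zero, zero_div, zero_mul]
  rw [hsum, Finset.sum_sub_distrib, ← Finset.sum_div, ← Finset.sum_mul, h₁, h₂,
    mul_div_cancel₀ _ hN.ne']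
  ring

/-- For `n = m+1 ≥ 2`, `q ≥ 2` and `R ∈ [m]`, the minimum of `H^In_{1-Del}` over all
channel outputs in `Σ_{q,R}^m` equals
`log₂(nq) - ((m-R+2)log₂(m-R+2) + 2(R-1))/(nq)`,
and it is attained exactly by the skewed channel outputs. -/
theorem stmt_8 (q m R : ℕ) (hq : 2 ≤ q) (hm : 1 ≤ m) (hR1 : 1 ≤ R) (hRm : R ≤ m) :
    IsLeast
      ((fun y : Fin m → Fin q => Hdel q (m + 1) 1 y) ''
        {y | (runLengths (List.ofFn y)).length = R})
      (Real.logb 2 (((m : ℝ) + 1) * q)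
        - (((m - R + 2 : ℕ) : ℝ) * Real.logb 2 ((m - R + 2 : ℕ) : ℝ)
            + 2 * ((R - 1 : ℕ) : ℝ)) / (((m : ℝ) + 1) * q))
    ∧ ∀ y : Fin m → Fin q, (runLengths (List.ofFn y)).length = R →
        (Hdel q (m + 1) 1 y =
            Real.logb 2 (((m : ℝ) + 1) * q)
              - (((m - R + 2 : ℕ) : ℝ) * Real.logb 2 ((m - R + 2 : ℕ) : ℝ)
                  + 2 * ((R - 1 : ℕ) : ℝ)) / (((m : ℝ) + 1) * q)
          ↔ isSkewed m R (runLengths (List.ofFn y))) := by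
  have hN : (0 : ℝ) < ((m : ℝ) + 1) * q := by positivity
  have hlb : ∀ y : Fin m → Fin q, (runLengths (List.ofFn y)).length = R →
      ((runLengths (List.ofFn y)).map fun r => mulLogb (r + 1)).sum ≤
          mulLogb (m - R + 2) + 2 * ((R - 1 : ℕ) : ℝ) ∧
        (((runLengths (List.ofFn y)).map fun r => mulLogb (r + 1)).sum =
            mulLogb (m - R + 2) + 2 * ((R - 1 : ℕ) : ℝ) →
          isSkewed m R (runLengths (List.ofFn y))) := by
    intro y hy
    have h := sum_mulLogb_le (runLengths (List.ofFn y)) (one_le_of_mem_runLengths _)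
      (List.length_pos_iff.1 (by omega))
    rwa [sum_runLengths, hy, List.length_ofFn] at h
  have hiff : ∀ y : Fin m → Fin q, (runLengths (List.ofFn y)).length = R →
      (Hdel q (m + 1) 1 y =
          Real.logb 2 (((m : ℝ) + 1) * q)
            - (((m - R + 2 : ℕ) : ℝ) * Real.logb 2 ((m - R + 2 : ℕ) : ℝ)
                + 2 * ((R - 1 : ℕ) : ℝ)) / (((m : ℝ) + 1) * q)
        ↔ isSkewed m R (runLengths (List.ofFn y))) := by
    intro y hy
    rw [Hdel_one_eq (by omega), sub_right_inj, div_left_inj' hN.ne']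
    exact ⟨(hlb y hy).2, sum_mulLogb_of_isSkewed hR1 hRm⟩
  refine ⟨⟨?_, ?_⟩, hiff⟩
  · have : Nontrivial (Fin q) := Fin.nontrivial_iff_two_le.2 hq
    obtain ⟨l, hl⟩ := exists_runLengths_eq_replicate_append (R - 1) (m - R) (⟨0, by omega⟩ : Fin q)
    have hlen := sum_runLengths (⟨0, by omega⟩ :: l : List (Fin q))
    rw [hl] at hlen
    obtain ⟨y, hy⟩ := exists_ofFn_eq (m := m) (hlen.symm.trans (by simp; omega))
    rw [← hy] at hl
    have hy' : (runLengths (List.ofFn y)).length = R := by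
      rw [hl]
      simp
      omega
    refine ⟨y, hy', (hiff y hy').2 ?_⟩
    rw [hl, isSkewed, show m - (R - 1) = m - R + 1 by omega]
    exact List.perm_append_comm
  · rintro _ ⟨y, hy, rfl⟩
    simp only [Hdel_one_eq (by omega : 0 < q)]
    gcongr
    exact (hlb y hy).1

end
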